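/- (Degree form of the Diregularity Lemma.) For every ε ∈ (0,1) and all positive integers M', M'' there are numbers M and n₀ such that: if G is a digraph on n ≥ n₀ vertices, U₀, …, U_{M''} is a partition of V(G), and d ∈ [0,1], then there is a partition V₀, V₁, …, V_k of V(G) and a spanning subdigraph G' of G such that: M' ≤ k ≤ M; |V₀| ≤ εn; |V₁| = … = |V_k| = m; the partition V₀, V₁, …, V_k refines U₀, …, U_{M''} (i.e. every V_i with i ≥ 1 is contained in some U_j); d⁺_{G'}(x) > d⁺_G(x) − (d+ε)n and d⁻_{G'}(x) > d⁻_G(x) − (d+ε)n for all vertices x; G'[V_i] is empty for each i = 1, …, k; and for all 1 ≤ i, j ≤ k with i ≠ j, the bipartite graph whose vertex classes are V_i and V_j and whose edges are all the V_i–V_j edges in G' is ε-regular with density either 0 or at least d. -/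

import Mathlib

open Set

namespace ArxivOG

variable {V : Type*}

/-- An oriented graph: at most one directed edge between any two vertices (and no loops). -/
def IsOriented (G : V → V → Prop) : Prop := ∀ x y : V, G x y → ¬ G y x

/-- Out-neighbourhood of a vertex. -/
def outN (G : V → V → Prop) (x : V) : Set V := {y | G x y}

/-- In-neighbourhood of a vertex. -/
def inN (G : V → V → Prop) (x : V) : Set V := {y | G y x}

/-- Outdegree of a vertex. -/
noncomputable def outDeg (G : V → V → Prop) (x : V) : ℕ := (outN G x).ncard

/-- Indegree of a vertex. -/
noncomputable def inDeg (G : V → V → Prop) (x : V) : ℕ := (inN G x).ncard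

/-- The set of all outneighbours of vertices in `S`. -/
def outNSet (G : V → V → Prop) (S : Set V) : Set V := {y | ∃ x ∈ S, G x y}

/-- Minimum outdegree `δ⁺`. -/
noncomputable def minOutDeg (G : V → V → Prop) : ℕ := sInf (Set.range (outDeg G))

/-- Minimum indegree `δ⁻`. -/
noncomputable def minInDeg (G : V → V → Prop) : ℕ := sInf (Set.range (inDeg G))

/-- Minimum semi-degree `δ⁰ = min (δ⁺, δ⁻)`. -/
noncomputable def minSemiDeg (G : V → V → Prop) : ℕ := min (minOutDeg G) (minInDeg G)

/-- A Hamilton cycle of a digraph, encoded as a permutation `σ` of the vertex set all of whose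
vertices lie on a single cycle and such that every vertex sends an edge to its successor. -/
def IsHamCycle (G : V → V → Prop) (σ : Equiv.Perm V) : Prop :=
  (∀ v, G v (σ v)) ∧ ∀ v w : V, σ.SameCycle v w

/-- The number of edges directed from `A` to `B`. -/
noncomputable def eCnt (G : V → V → Prop) (A B : Set V) : ℕ :=
  {p : V × V | p.1 ∈ A ∧ p.2 ∈ B ∧ G p.1 p.2}.ncard

/-- The density of the bipartite graph of all `A`–`B` edges. -/
noncomputable def dens (G : V → V → Prop) (A B : Set V) : ℝ :=
  (eCnt G A B : ℝ) / ((A.ncard : ℝ) * (B.ncard : ℝ))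

/-- The pair `(A,B)` is `ε`-regular. -/
def EpsRegular (ε : ℝ) (G : V → V → Prop) (A B : Set V) : Prop :=
  ∀ X ⊆ A, ∀ Y ⊆ B, ε * A.ncard < (X.ncard : ℝ) → ε * B.ncard < (Y.ncard : ℝ) →
    |dens G X Y - dens G A B| < ε

/-- The pair `(A,B)` is `(ε,d)`-super-regular. -/
def SuperRegular (ε d : ℝ) (G : V → V → Prop) (A B : Set V) : Prop :=
  EpsRegular ε G A B ∧
  (∀ a ∈ A, (d - ε) * B.ncard ≤ ((outN G a ∩ B).ncard : ℝ)) ∧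
  (∀ b ∈ B, (d - ε) * A.ncard ≤ ((inN G b ∩ A).ncard : ℝ))

/-- The cluster `V_i` of a partition encoded by `P : V → Option (Fin k)`. -/
def cluster {k : ℕ} (P : V → Option (Fin k)) (i : Fin k) : Set V := {x | P x = some i}

/-- The exceptional set `V₀` of a partition encoded by `P : V → Option (Fin k)`. -/
def cluster0 {k : ℕ} (P : V → Option (Fin k)) : Set V := {x | P x = none}

section Auxiliary

open scoped Classical

section FiberMean

variable {Ω κ κ' : Type*} [Fintype Ω]

/-- The mean of `g` over the fibre of `F` above `c`. -/
noncomputable def fiberMean (F : Ω → κ) (g : Ω → ℝ) (c : κ) : ℝ :=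
  (∑ ω with F ω = c, g ω) / ((Finset.univ.filter fun ω => F ω = c).card : ℝ)

/-- The squared `L²`-norm of the conditional expectation of `g` given `F`. -/
noncomputable def energy (F : Ω → κ) (g : Ω → ℝ) : ℝ := ∑ ω, fiberMean F g (F ω) ^ 2

lemma sum_fiberMean_mul [Fintype κ] (F : Ω → κ) (g : Ω → ℝ) (H : κ → ℝ) :
    ∑ ω, fiberMean F g (F ω) * H (F ω) = ∑ ω, g ω * H (F ω) := by
  rw [← Finset.sum_fiberwise Finset.univ F, ← Finset.sum_fiberwise Finset.univ F]
  refine Finset.sum_congr rfl fun c _ => ?_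
  have h1 : ∑ ω with F ω = c, fiberMean F g (F ω) * H (F ω)
      = ∑ ω with F ω = c, fiberMean F g c * H c :=
    Finset.sum_congr rfl fun ω hω => by rw [(Finset.mem_filter.1 hω).2]
  have h2 : ∑ ω with F ω = c, g ω * H (F ω) = ∑ ω with F ω = c, g ω * H c :=
    Finset.sum_congr rfl fun ω hω => by rw [(Finset.mem_filter.1 hω).2]
  rw [h1, h2, Finset.sum_const, nsmul_eq_mul, fiberMean, ← mul_assoc, ← Finset.sum_mul]
  congr 1
  by_cases h : (Finset.univ.filter fun ω => F ω = c).card = 0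
  · simp [Finset.card_eq_zero.1 h]
  · have : ((Finset.univ.filter fun ω => F ω = c).card : ℝ) ≠ 0 := by exact_mod_cast h
    field_simp

lemma sum_sq_fiberMean_sub [Fintype κ] [Fintype κ'] (F : Ω → κ) (F' : Ω → κ') (φ : κ' → κ) (h : ∀ ω, F ω = φ (F' ω))
    (g : Ω → ℝ) :
    ∑ ω, (fiberMean F' g (F' ω) - fiberMean F g (F ω)) ^ 2 = energy F' g - energy F g := by
  have h1 := sum_fiberMean_mul F' g fun c => fiberMean F g (φ c)
  have h2 := sum_fiberMean_mul F g (fiberMean F g)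
  simp only [← h] at h1
  simp only [energy, sub_sq, Finset.sum_add_distrib, Finset.sum_sub_distrib, mul_assoc,
    ← Finset.mul_sum, h1, ← h2]
  simp only [sq]
  ring

lemma energy_nonneg (F : Ω → κ) (g : Ω → ℝ) : 0 ≤ energy F g :=
  Finset.sum_nonneg fun _ _ => sq_nonneg _

lemma energy_le_card [Fintype κ] (F : Ω → κ) (g : Ω → ℝ) (hg : ∀ ω, g ω ^ 2 ≤ 1) :
    energy F g ≤ Fintype.card Ω := by
  have h2 := sum_fiberMean_mul F g (fiberMean F g)
  have h3 : 0 ≤ ∑ ω, (g ω - fiberMean F g (F ω)) ^ 2 := Finset.sum_nonneg fun _ _ => sq_nonneg _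
  simp only [sub_sq, Finset.sum_add_distrib, Finset.sum_sub_distrib, mul_assoc,
    ← Finset.mul_sum, ← h2] at h3
  simp only [← sq] at h3
  have h4 : ∑ ω, g ω ^ 2 ≤ ∑ _ω : Ω, (1 : ℝ) := Finset.sum_le_sum fun ω _ => hg ω
  simp only [Finset.sum_const, Finset.card_univ, nsmul_eq_mul, mul_one] at h4
  unfold energy
  linarith

lemma energy_mono [Fintype κ] [Fintype κ'] (F : Ω → κ) (F' : Ω → κ') (φ : κ' → κ) (h : ∀ ω, F ω = φ (F' ω))
    (g : Ω → ℝ) : energy F g ≤ energy F' g := by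
  have h1 := sum_sq_fiberMean_sub F F' φ h g
  have h2 : 0 ≤ ∑ ω, (fiberMean F' g (F' ω) - fiberMean F g (F ω)) ^ 2 :=
    Finset.sum_nonneg fun _ _ => sq_nonneg _
  linarith

end FiberMean

section Digraph

variable [Fintype V]

/-- The indicator function of the edge set. -/
noncomputable def edgeInd (G : V → V → Prop) (p : V × V) : ℝ := if G p.1 p.2 then 1 else 0

lemma eCnt_eq_sum (G : V → V → Prop) (A B : Set V) :
    (eCnt G A B : ℝ) = ∑ p : V × V with p.1 ∈ A ∧ p.2 ∈ B, edgeInd G p := by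
  simp only [eCnt, edgeInd, Finset.sum_boole, Finset.filter_filter, Set.ncard_eq_toFinset_card',
    Set.toFinset_ofPred, and_assoc]

lemma card_prod_filter (A B : Set V) :
    ((Finset.univ.filter fun p : V × V => p.1 ∈ A ∧ p.2 ∈ B).card : ℝ)
      = (A.ncard : ℝ) * B.ncard := by
  rw [← Nat.cast_mul, ← Set.ncard_prod, Set.ncard_eq_toFinset_card']
  congr 2
  ext p
  simp

lemma dens_fiber (G : V → V → Prop) {ι : Type*} [Fintype ι] (f : V → ι) (c : ι × ι) :
    fiberMean (Prod.map f f) (edgeInd G) c = dens G {x | f x = c.1} {x | f x = c.2} := by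
  have h (p : V × V) : Prod.map f f p = c ↔ p.1 ∈ {x | f x = c.1} ∧ p.2 ∈ {x | f x = c.2} := by
    simp [Prod.ext_iff]
  rw [dens, ← card_prod_filter, eCnt_eq_sum]
  simp only [fiberMean, h]

lemma energy_increment (G : V → V → Prop) {ι ι' : Type*} [Fintype ι] [Fintype ι']
    (f : V → ι) (f' : V → ι') (φ : ι' → ι) (hφ : ∀ x, f x = φ (f' x)) {ε : ℝ} (hε : 0 < ε)
    (hf' : ∀ c : ι × ι, ¬ EpsRegular ε G {x | f x = c.1} {x | f x = c.2} →
      ∃ X ⊆ {x | f x = c.1}, ∃ Y ⊆ {x | f x = c.2},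
        ε * ({x | f x = c.1}.ncard : ℝ) < X.ncard ∧ ε * ({x | f x = c.2}.ncard : ℝ) < Y.ncard ∧
        ε ≤ |dens G X Y - dens G {x | f x = c.1} {x | f x = c.2}| ∧
        ∃ X' Y' : Set ι', X = f' ⁻¹' X' ∧ Y = f' ⁻¹' Y') :
    energy (Prod.map f f) (edgeInd G)
      + ε ^ 4 * ((Finset.univ.filter fun p : V × V =>
        ¬ EpsRegular ε G {x | f x = f p.1} {x | f x = f p.2}).card : ℝ)
      ≤ energy (Prod.map f' f') (edgeInd G) := by
  have hpy := sum_sq_fiberMean_sub (Prod.map f f) (Prod.map f' f') (Prod.map φ φ)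
    (fun ω => by simp [Prod.ext_iff, hφ]) (edgeInd G)
  set D : V × V → ℝ := fun ω => fiberMean (Prod.map f' f') (edgeInd G) (Prod.map f' f' ω)
    - fiberMean (Prod.map f f) (edgeInd G) (Prod.map f f ω) with hD
  suffices h : ε ^ 4 * ((Finset.univ.filter fun p : V × V =>
        ¬ EpsRegular ε G {x | f x = f p.1} {x | f x = f p.2}).card : ℝ) ≤ ∑ ω, D ω ^ 2 by
    linarith
  rw [Finset.cast_card, Finset.sum_filter, Finset.mul_sum,
    ← Finset.sum_fiberwise Finset.univ (Prod.map f f),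
    ← Finset.sum_fiberwise Finset.univ (Prod.map f f) (fun ω => D ω ^ 2)]
  refine Finset.sum_le_sum fun c _ => ?_
  have hset : (Finset.univ.filter fun p : V × V => Prod.map f f p = c)
      = Finset.univ.filter fun p : V × V => p.1 ∈ {x | f x = c.1} ∧ p.2 ∈ {x | f x = c.2} := by
    ext p
    simp [Prod.ext_iff]
  by_cases hc : EpsRegular ε G {x | f x = c.1} {x | f x = c.2}
  · rw [Finset.sum_eq_zero]
    · exact Finset.sum_nonneg fun _ _ => sq_nonneg _
    · intro p hp
      have := (Finset.mem_filter.1 hp).2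
      subst this
      simp only [Prod.map_fst, Prod.map_snd] at hc
      simp [hc]
  · obtain ⟨X, hX, Y, hY, hXc, hYc, hd, X', Y', hX', hY'⟩ := hf' c hc
    set A := {x | f x = c.1}
    set B := {x | f x = c.2}
    have hl : ∑ p : V × V with Prod.map f f p = c,
        ε ^ 4 * (if ¬ EpsRegular ε G {x | f x = f p.1} {x | f x = f p.2} then (1 : ℝ) else 0)
        ≤ ε ^ 4 * ((A.ncard : ℝ) * B.ncard) := by
      rw [← Finset.mul_sum, ← card_prod_filter, ← hset, Finset.cast_card]
      gcongr
      split_ifs <;> norm_num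
    refine hl.trans ?_
    set S := Finset.univ.filter fun p : V × V => p.1 ∈ X ∧ p.2 ∈ Y with hS
    have hScard : (S.card : ℝ) = (X.ncard : ℝ) * Y.ncard := card_prod_filter X Y
    have hsub : S ⊆ Finset.univ.filter fun p : V × V => Prod.map f f p = c := by
      rw [hset]
      intro p hp
      simp only [hS, Finset.mem_filter, Finset.mem_univ, true_and] at hp ⊢
      exact ⟨hX hp.1, hY hp.2⟩
    have hXpos : (0 : ℝ) < X.ncard := lt_of_le_of_lt (by positivity) hXc
    have hYpos : (0 : ℝ) < Y.ncard := lt_of_le_of_lt (by positivity) hYc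
    have hsum : ∑ ω ∈ S, D ω = (X.ncard : ℝ) * Y.ncard * (dens G X Y - dens G A B) := by
      have e1 : ∑ ω ∈ S, fiberMean (Prod.map f' f') (edgeInd G) (Prod.map f' f' ω)
          = eCnt G X Y := by
        have := sum_fiberMean_mul (Prod.map f' f') (edgeInd G)
          (fun q => if q.1 ∈ X' ∧ q.2 ∈ Y' then 1 else 0)
        rw [eCnt_eq_sum, Finset.sum_filter, Finset.sum_filter]
        subst hX' hY'
        simpa using this
      have e2 : ∑ ω ∈ S, fiberMean (Prod.map f f) (edgeInd G) (Prod.map f f ω)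
          = ∑ ω ∈ S, dens G A B := by
        refine Finset.sum_congr rfl fun ω hω => ?_
        rw [(Finset.mem_filter.1 (hsub hω)).2, dens_fiber]
      rw [hD, Finset.sum_sub_distrib, e1, e2, Finset.sum_const, nsmul_eq_mul, hScard, mul_sub]
      congr 1
      rw [dens]
      field_simp
    have hcs : (∑ ω ∈ S, D ω) ^ 2 ≤ S.card * ∑ ω ∈ S, D ω ^ 2 := sq_sum_le_card_mul_sum_sq
    rw [hsum, hScard, mul_pow, sq ((X.ncard : ℝ) * Y.ncard), mul_assoc] at hcs
    have hcs' := le_of_mul_le_mul_left hcs (by positivity)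
    have hd2 : ε ^ 2 ≤ (dens G X Y - dens G A B) ^ 2 := by
      rw [← sq_abs (dens G X Y - dens G A B)]
      gcongr
    calc ε ^ 4 * ((A.ncard : ℝ) * B.ncard)
        = (ε * A.ncard) * (ε * B.ncard) * ε ^ 2 := by ring
      _ ≤ (X.ncard : ℝ) * Y.ncard * (dens G X Y - dens G A B) ^ 2 := by gcongr
      _ ≤ ∑ ω ∈ S, D ω ^ 2 := hcs'
      _ ≤ _ := Finset.sum_le_sum_of_subset_of_nonneg hsub fun _ _ _ => sq_nonneg _

lemma exists_chunk_labelling (A : Set V) {m : ℕ} (hm : 0 < m) :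
    ∃ c : V → ℕ, (∀ x, c x ≤ A.ncard / m) ∧
      (∀ j < A.ncard / m, {x | x ∈ A ∧ c x = j}.ncard = m) ∧
      {x | x ∈ A ∧ c x = A.ncard / m}.ncard ≤ m := by
  let e : A ≃ Fin A.ncard := Finite.equivFinOfCardEq (Nat.card_coe_set_eq A)
  have key (j : ℕ) : {x | x ∈ A ∧ (if h : x ∈ A then (e ⟨x, h⟩ : ℕ) / m else 0) = j}.ncard
      = ((Finset.range A.ncard).filter fun r => r / m = j).card := by
    rw [← Set.ncard_coe_finset]
    refine Set.ncard_congr' ?_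
    refine
      { toFun := fun x => ⟨(e ⟨x.1, x.2.1⟩ : ℕ), ?_⟩
        invFun := fun r => ⟨(e.symm ⟨r.1, ?_⟩ : V), ?_⟩
        left_inv := ?_
        right_inv := ?_ }
    · have := x.2.2
      simp only [x.2.1, dif_pos] at this
      simp [this]
    · exact Finset.mem_range.1 (Finset.mem_filter.1 (Finset.mem_coe.1 r.2)).1
    · have := (Finset.mem_filter.1 (Finset.mem_coe.1 r.2)).2
      simp [this]
    · intro x
      simp
    · intro r
      simp
  refine ⟨fun x => if h : x ∈ A then (e ⟨x, h⟩ : ℕ) / m else 0, ?_, ?_, ?_⟩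
  · intro x
    dsimp only
    split_ifs with h
    · exact Nat.div_le_div_right (e ⟨x, h⟩).2.le
    · exact Nat.zero_le _
  · intro j hj
    rw [key]
    have : (Finset.range A.ncard).filter (fun r => r / m = j)
        = Finset.Ico (j * m) ((j + 1) * m) := by
      ext r
      have h1 : (j + 1) * m ≤ A.ncard :=
        (Nat.mul_le_mul_right m hj).trans (Nat.div_mul_le_self _ _)
      simp only [Finset.mem_filter, Finset.mem_range, Finset.mem_Ico, Nat.div_eq_iff hm]
      rw [Nat.add_mul] at *
      omega
    rw [this, Nat.card_Ico, Nat.add_mul]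
    omega
  · rw [key]
    refine (Finset.card_le_card (t := Finset.Ico (A.ncard / m * m) ((A.ncard / m + 1) * m))
      fun r hr => ?_).trans ?_
    · simp only [Finset.mem_filter, Finset.mem_range, Nat.div_eq_iff hm] at hr
      rw [Finset.mem_Ico, Nat.add_mul]
      omega
    · rw [Nat.card_Ico, Nat.add_mul]
      omega

lemma exists_chunk_refinement {ι : Type*} [Fintype ι] (f : V → ι) {m B : ℕ} (hm : 0 < m)
    (hB : Fintype.card V / m ≤ B) :
    ∃ f' : V → ι × Fin (B + 1), (∀ x, (f' x).1 = f x) ∧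
      (Finset.univ.filter fun x => {y | f' y = f' x}.ncard ≠ m).card ≤ Fintype.card ι * m := by
  choose c hc1 hc2 hc3 using fun a : ι => exists_chunk_labelling {x | f x = a} hm
  have hlt (a : ι) (x : V) : c a x < B + 1 := by
    refine Nat.lt_succ_of_le ((hc1 a x).trans (le_trans (Nat.div_le_div_right ?_) hB))
    rw [← Nat.card_eq_fintype_card]
    exact Set.ncard_le_card _
  refine ⟨fun x => (f x, ⟨c (f x) x, hlt _ _⟩), fun x => rfl, ?_⟩
  have hsub : (Finset.univ.filter fun x =>
      {y | ((f y, ⟨c (f y) y, hlt _ _⟩) : ι × Fin (B + 1))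
        = (f x, ⟨c (f x) x, hlt _ _⟩)}.ncard ≠ m)
      ⊆ Finset.univ.biUnion fun a : ι => Finset.univ.filter fun x =>
        x ∈ {x | f x = a} ∧ c a x = {x | f x = a}.ncard / m := by
    intro x hx
    simp only [Finset.mem_filter, Finset.mem_univ, true_and] at hx
    simp only [Finset.mem_biUnion, Finset.mem_filter, Finset.mem_univ, true_and]
    refine ⟨f x, rfl, ?_⟩
    by_contra hne
    refine hx ?_
    rw [← hc2 (f x) (c (f x) x) (lt_of_le_of_ne (hc1 _ _) hne)]
    congr 1
    ext y
    simp only [Set.mem_ofPred_eq, Prod.mk.injEq, Fin.mk.injEq]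
    refine and_congr_right fun h => ?_
    rw [h]
  refine (Finset.card_le_card hsub).trans ?_
  rw [← Finset.card_univ (α := ι)]
  refine Finset.card_biUnion_le_card_mul _ _ _ fun a _ => ?_
  refine le_trans (le_of_eq ?_) (hc3 a)
  rw [← Set.ncard_coe_finset, Finset.coe_filter_univ]

end Digraph

/-- The partition of `Fin n` into the fibres of `f` refines the one given by `Q`, and all but
at most `γ n` vertices lie in fibres of size exactly `m`, where `0 < m ≤ γ n`. -/
structure IsChunking {n L : ℕ} {ι : Type*} (γ : ℝ) (Q : Fin n → ι) (f : Fin n → Fin L) (m : ℕ) :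
    Prop where
  factors : ∃ φ : Fin L → ι, ∀ x, Q x = φ (f x)
  pos : 0 < m
  size_le : (m : ℝ) ≤ γ * n
  card_le : ((Finset.univ.filter fun x => {y | f y = f x}.ncard ≠ m).card : ℝ) ≤ γ * n

lemma exists_isChunking {γ : ℝ} (hγ : 0 < γ) {K : ℕ} (hK : 0 < K) :
    ∃ M n₀ : ℕ, ∀ n : ℕ, n₀ ≤ n → ∀ (ι : Type) [Fintype ι], Fintype.card ι ≤ K →
      ∀ Q : Fin n → ι, ∃ L ≤ M, ∃ (f : Fin n → Fin L) (m : ℕ), IsChunking γ Q f m := by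
  refine ⟨K * (⌈2 * K / γ⌉₊ + 1), ⌈K / γ⌉₊, fun n hn ι _ hι Q => ?_⟩
  have hK' : (0 : ℝ) < K := by exact_mod_cast hK
  have hK1 : (1 : ℝ) ≤ K := by exact_mod_cast hK
  have hn' : (K : ℝ) / γ ≤ n := (Nat.le_ceil _).trans (by exact_mod_cast hn)
  have h1 : 1 ≤ γ * n / K := by
    rw [div_le_iff₀ hγ] at hn'
    rw [le_div_iff₀ hK']
    linarith
  set m := ⌊γ * n / K⌋₊ with hmdef
  have hm : 0 < m := Nat.floor_pos.2 h1
  have hmle : (m : ℝ) ≤ γ * n / K := Nat.floor_le (by linarith)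
  have hlt : γ * n / K < m + 1 := Nat.lt_floor_add_one _
  have hm1 : (1 : ℝ) ≤ m := by exact_mod_cast hm
  have hKm : (K : ℝ) * m ≤ γ * n := by
    rw [le_div_iff₀ hK'] at hmle
    linarith
  have hB : Fintype.card (Fin n) / m ≤ ⌈2 * K / γ⌉₊ := by
    rw [Fintype.card_fin]
    have : ((n / m : ℕ) : ℝ) ≤ ⌈2 * K / γ⌉₊ := by
      refine Nat.cast_div_le.trans (le_trans ?_ (Nat.le_ceil _))
      rw [div_le_div_iff₀ (by linarith) hγ]
      have : γ * n < (m + 1) * K := (div_lt_iff₀ hK').1 hlt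
      nlinarith
    exact_mod_cast this
  obtain ⟨f', hf', hcard⟩ := exists_chunk_refinement Q hm hB
  let e := Fintype.equivFin (ι × Fin (⌈2 * K / γ⌉₊ + 1))
  refine ⟨_, ?_, e ∘ f', m, ⟨fun l => (e.symm l).1, fun x => by simp [hf']⟩, hm, ?_, ?_⟩
  · rw [Fintype.card_prod, Fintype.card_fin]
    exact Nat.mul_le_mul_right _ hι
  · nlinarith
  · simp only [Function.comp_apply, EmbeddingLike.apply_eq_iff_eq]
    calc _ ≤ ((Fintype.card ι * m : ℕ) : ℝ) := by exact_mod_cast hcard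
      _ ≤ K * m := by
        push_cast
        gcongr
      _ ≤ _ := hKm

/-- The pairs of vertices whose fibres under `f` form a pair that is not `ε`-regular. -/
noncomputable def irregPairs {n : ℕ} {ι : Type*} (ε : ℝ) (G : Fin n → Fin n → Prop)
    (f : Fin n → ι) : Finset (Fin n × Fin n) :=
  Finset.univ.filter fun p => ¬ EpsRegular ε G {x | f x = f p.1} {x | f x = f p.2}

lemma exists_witness_refinement {n L : ℕ} {ε : ℝ} (hε : 0 < ε) (G : Fin n → Fin n → Prop)
    (f : Fin n → Fin L) :
    ∃ f' : Fin n → Fin L × (Fin L × Fin L → Prop × Prop), (∀ x, (f' x).1 = f x) ∧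
      energy (Prod.map f f) (edgeInd G) + ε ^ 4 * ((irregPairs ε G f).card : ℝ)
        ≤ energy (Prod.map f' f') (edgeInd G) := by
  have hw (c : Fin L × Fin L) : ∃ X Y : Set (Fin n),
      ¬ EpsRegular ε G {x | f x = c.1} {x | f x = c.2} →
      X ⊆ {x | f x = c.1} ∧ Y ⊆ {x | f x = c.2} ∧
        ε * ({x | f x = c.1}.ncard : ℝ) < X.ncard ∧ ε * ({x | f x = c.2}.ncard : ℝ) < Y.ncard ∧
        ε ≤ |dens G X Y - dens G {x | f x = c.1} {x | f x = c.2}| := by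
    by_cases h : EpsRegular ε G {x | f x = c.1} {x | f x = c.2}
    · exact ⟨∅, ∅, fun h' => absurd h h'⟩
    · have h' := h
      unfold EpsRegular at h'
      push Not at h'
      obtain ⟨X, hX, Y, hY, h1, h2, h3⟩ := h'
      exact ⟨X, Y, fun _ => ⟨hX, hY, h1, h2, h3⟩⟩
  choose X Y hXY using hw
  refine ⟨fun x => (f x, fun c => (x ∈ X c, x ∈ Y c)), fun x => rfl, ?_⟩
  refine energy_increment G f _ Prod.fst (fun x => rfl) hε fun c hc => ?_
  obtain ⟨h1, h2, h3, h4, h5⟩ := hXY c hc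
  exact ⟨X c, h1, Y c, h2, h3, h4, h5, {z | (z.2 c).1}, {z | (z.2 c).2}, rfl, rfl⟩

lemma exists_chunking_regular_or_energy {ε γ : ℝ} (hε : 0 < ε) (hγ : 0 < γ) {K : ℕ}
    (hK : 0 < K) (t : ℕ) :
    ∃ M n₀ : ℕ, ∀ n : ℕ, n₀ ≤ n → ∀ (G : Fin n → Fin n → Prop) (Q : Fin n → Fin K),
      ∃ L ≤ M, ∃ (f : Fin n → Fin L) (m : ℕ), IsChunking γ Q f m ∧
        (((irregPairs ε G f).card : ℝ) ≤ ε * n ^ 2 ∨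
          t * ε ^ 5 * n ^ 2 ≤ energy (Prod.map f f) (edgeInd G)) := by
  induction t with
  | zero =>
    obtain ⟨M, n₀, h⟩ := exists_isChunking hγ hK
    refine ⟨M, n₀, fun n hn G Q => ?_⟩
    obtain ⟨L, hL, f, m, hf⟩ := h n hn (Fin K) (by simp) Q
    refine ⟨L, hL, f, m, hf, Or.inr ?_⟩
    simpa using energy_nonneg _ _
  | succ t ih =>
    obtain ⟨M, n₀, ih⟩ := ih
    obtain ⟨M', n₀', h⟩ := exists_isChunking hγ (K := M * (2 * 2) ^ (M * M) + 1) (by omega)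
    refine ⟨max M M', max n₀ n₀', fun n hn G Q => ?_⟩
    obtain ⟨L, hL, f, m, hf, hreg⟩ := ih n ((le_max_left _ _).trans hn) G Q
    by_cases hirr : ((irregPairs ε G f).card : ℝ) ≤ ε * n ^ 2
    · exact ⟨L, hL.trans (le_max_left _ _), f, m, hf, Or.inl hirr⟩
    have hen := hreg.resolve_left hirr
    obtain ⟨f', hf', hinc⟩ := exists_witness_refinement hε G f
    have hcard : Fintype.card (Fin L × (Fin L × Fin L → Prop × Prop))
        ≤ M * (2 * 2) ^ (M * M) + 1 := by
      simp only [Fintype.card_prod, Fintype.card_fin, Fintype.card_prop,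
        Fintype.card_fun]
      refine le_trans ?_ (Nat.le_succ _)
      gcongr
      norm_num
    obtain ⟨L', hL', f'', m', hf''⟩ := h n ((le_max_right _ _).trans hn) _ hcard f'
    obtain ⟨φ, hφ⟩ := hf.factors
    obtain ⟨ψ, hψ⟩ := hf''.factors
    refine ⟨L', hL'.trans (le_max_right _ _), f'', m',
      ⟨⟨fun l => φ (ψ l).1, fun x => by rw [hφ, ← hf', hψ]⟩, hf''.pos, hf''.size_le,
        hf''.card_le⟩, Or.inr ?_⟩
    have hmono := energy_mono (Prod.map f' f') (Prod.map f'' f'') (Prod.map ψ ψ)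
      (fun ω => by simp [Prod.ext_iff, hψ]) (edgeInd G)
    push Not at hirr
    have : ε ^ 4 * (ε * n ^ 2) ≤ ε ^ 4 * ((irregPairs ε G f).card : ℝ) := by gcongr
    push_cast
    linarith

/-- A Szemerédi-type regularity lemma for digraphs, refining a given partition. -/
lemma exists_chunking_regular {ε γ : ℝ} (hε : 0 < ε) (hγ : 0 < γ) {K : ℕ} (hK : 0 < K) :
    ∃ M n₀ : ℕ, ∀ n : ℕ, n₀ ≤ n → ∀ (G : Fin n → Fin n → Prop) (Q : Fin n → Fin K),
      ∃ L ≤ M, ∃ (f : Fin n → Fin L) (m : ℕ), IsChunking γ Q f m ∧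
        ((irregPairs ε G f).card : ℝ) ≤ ε * n ^ 2 := by
  obtain ⟨t, ht⟩ := exists_nat_gt (1 / ε ^ 5)
  obtain ⟨M, n₀, h⟩ := exists_chunking_regular_or_energy hε hγ hK t
  refine ⟨M, max n₀ 1, fun n hn G Q => ?_⟩
  obtain ⟨L, hL, f, m, hf, hreg⟩ := h n ((le_max_left _ _).trans hn) G Q
  refine ⟨L, hL, f, m, hf, hreg.resolve_right fun hen => ?_⟩
  have hle := energy_le_card (Prod.map f f) (edgeInd G)
    (fun p => by unfold edgeInd; split_ifs <;> norm_num)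
  have hn1 : (1 : ℝ) ≤ n := by exact_mod_cast (le_max_right _ _).trans hn
  rw [div_lt_iff₀ (by positivity)] at ht
  have hn2 : (0 : ℝ) < (n : ℝ) ^ 2 := by positivity
  simp only [Fintype.card_prod, Fintype.card_fin, Nat.cast_mul] at hle
  nlinarith

section Pairs

lemma eCnt_flip (G : V → V → Prop) (A B : Set V) : eCnt (flip G) B A = eCnt G A B := by
  refine Set.ncard_congr (fun p _ => p.swap) ?_ ?_ ?_
  · rintro p ⟨h1, h2, h3⟩
    exact ⟨h2, h1, h3⟩
  · intro p q _ _ h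
    exact Prod.swap_injective h
  · rintro p ⟨h1, h2, h3⟩
    exact ⟨p.swap, ⟨h2, h1, h3⟩, Prod.swap_swap p⟩

lemma dens_flip (G : V → V → Prop) (A B : Set V) : dens (flip G) B A = dens G A B := by
  rw [dens, dens, eCnt_flip, mul_comm]

lemma EpsRegular.flip {ε : ℝ} {G : V → V → Prop} {A B : Set V} (h : EpsRegular ε G A B) :
    EpsRegular ε (flip G) B A := fun X hX Y hY h1 h2 => by
  rw [dens_flip, dens_flip]
  exact h Y hY X hX h2 h1

lemma epsRegular_flip {ε : ℝ} {G : V → V → Prop} {A B : Set V} :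
    EpsRegular ε (flip G) B A ↔ EpsRegular ε G A B := ⟨fun h => h.flip, fun h => h.flip⟩

lemma dens_congr {G G' : V → V → Prop} {A B : Set V} (h : ∀ x ∈ A, ∀ y ∈ B, G x y ↔ G' x y) :
    dens G A B = dens G' A B := by
  have : {p : V × V | p.1 ∈ A ∧ p.2 ∈ B ∧ G p.1 p.2}
      = {p : V × V | p.1 ∈ A ∧ p.2 ∈ B ∧ G' p.1 p.2} := by
    ext p
    exact and_congr_right fun h1 => and_congr_right fun h2 => h _ h1 _ h2
  rw [dens, dens, eCnt, eCnt, this]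

lemma dens_eq_zero {G : V → V → Prop} {A B : Set V} (h : ∀ x ∈ A, ∀ y ∈ B, ¬ G x y) :
    dens G A B = 0 := by
  have : {p : V × V | p.1 ∈ A ∧ p.2 ∈ B ∧ G p.1 p.2} = ∅ := by
    ext p
    simp only [Set.mem_ofPred_eq, Set.mem_empty_iff_false, iff_false, not_and]
    exact fun h1 h2 => h _ h1 _ h2
  rw [dens, eCnt, this]
  simp

lemma EpsRegular.congr {ε : ℝ} {G G' : V → V → Prop} {A B : Set V} (hG : EpsRegular ε G A B)
    (h : ∀ x ∈ A, ∀ y ∈ B, G x y ↔ G' x y) : EpsRegular ε G' A B := fun X hX Y hY h1 h2 => by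
  rw [← dens_congr h, ← dens_congr fun x hx y hy => h x (hX hx) y (hY hy)]
  exact hG X hX Y hY h1 h2

lemma epsRegular_of_forall_not {ε : ℝ} (hε : 0 < ε) {G : V → V → Prop} {A B : Set V}
    (h : ∀ x ∈ A, ∀ y ∈ B, ¬ G x y) : EpsRegular ε G A B := fun X hX Y hY _ _ => by
  rw [dens_eq_zero h, dens_eq_zero fun x hx y hy => h x (hX hx) y (hY hy)]
  simpa using hε

lemma EpsRegular.subset {δ ε : ℝ} {G : V → V → Prop} {A B X Y : Set V}
    (h : EpsRegular δ G A B) (hX : X ⊆ A) (hY : Y ⊆ B) (hXc : δ * A.ncard < X.ncard)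
    (hYc : δ * B.ncard < Y.ncard) (hXε : δ * A.ncard ≤ ε * X.ncard)
    (hYε : δ * B.ncard ≤ ε * Y.ncard) (hδε : 2 * δ ≤ ε) : EpsRegular ε G X Y := by
  intro X' hX' Y' hY' h1 h2
  have e1 := abs_lt.1 (h X hX Y hY hXc hYc)
  have e2 := abs_lt.1 (h X' (hX'.trans hX) Y' (hY'.trans hY) (hXε.trans_lt h1) (hYε.trans_lt h2))
  rw [abs_lt]
  constructor <;> linarith [e1.1, e1.2, e2.1, e2.2]

variable [Fintype V]

lemma eCnt_eq_sum_outN (G : V → V → Prop) (A B : Set V) :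
    (eCnt G A B : ℝ) = ∑ x with x ∈ A, ((outN G x ∩ B).ncard : ℝ) := by
  rw [eCnt_eq_sum, Finset.sum_filter, Fintype.sum_prod_type, Finset.sum_filter]
  refine Finset.sum_congr rfl fun x _ => ?_
  by_cases hx : x ∈ A
  · have : outN G x ∩ B = ↑(Finset.univ.filter fun y => y ∈ B ∧ G x y) := by
      ext y
      simp [outN, and_comm]
    rw [this, Set.ncard_coe_finset, Finset.cast_card, Finset.sum_filter]
    simp [hx, edgeInd, ← ite_and]
  · simp [hx]

lemma ncard_outN_large_le {δ : ℝ} (hδ : δ < 1) {G : V → V → Prop} {A B : Set V}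
    (hB : 0 < B.ncard) (h : EpsRegular δ G A B) :
    ({x | x ∈ A ∧ (dens G A B + δ) * B.ncard < ((outN G x ∩ B).ncard : ℝ)}.ncard : ℝ)
      ≤ δ * A.ncard := by
  by_contra! hlt
  have hB' : (0 : ℝ) < B.ncard := by exact_mod_cast hB
  obtain ⟨X, hX⟩ : ∃ X, X = {x | x ∈ A ∧
    (dens G A B + δ) * B.ncard < ((outN G x ∩ B).ncard : ℝ)} := ⟨_, rfl⟩
  rw [← hX] at hlt
  have hXmem : ∀ x ∈ X, x ∈ A ∧ (dens G A B + δ) * B.ncard < ((outN G x ∩ B).ncard : ℝ) := by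
    rw [hX]
    exact fun x hx => hx
  have habs := h X (fun x hx => (hXmem x hx).1) B subset_rfl hlt (by nlinarith)
  have hreg := (abs_lt.1 habs).2
  by_cases hX0 : X.ncard = 0
  · have hδ0 : δ ≤ 0 := by
      by_contra! hδ0
      rw [hX0] at hlt
      have : (0 : ℝ) ≤ δ * A.ncard := by positivity
      simp only [Nat.cast_zero] at hlt
      linarith
    linarith [abs_nonneg (dens G X B - dens G A B)]
  have hXpos : (0 : ℝ) < X.ncard := by exact_mod_cast Nat.pos_of_ne_zero hX0
  have hcnt : (X.ncard : ℝ) * ((dens G A B + δ) * B.ncard) ≤ eCnt G X B := by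
    rw [eCnt_eq_sum_outN]
    have : (X.ncard : ℝ) = ((Finset.univ.filter fun x => x ∈ X).card : ℝ) := by
      rw [← Set.ncard_coe_finset, Finset.coe_filter_univ]
      rfl
    rw [this, ← nsmul_eq_mul]
    exact Finset.card_nsmul_le_sum _ _ _ fun x hx => (hXmem x (Finset.mem_filter.1 hx).2).2.le
  have : dens G A B + δ ≤ dens G X B := by
    rw [show dens G X B = eCnt G X B / (X.ncard * B.ncard) from rfl,
      le_div_iff₀ (by positivity)]
    linarith
  linarith

end Pairs

lemma card_filter_lt_le {α : Type*} (s : Finset α) (w : α → ℕ) {C D : ℝ} (hC : 0 < C)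
    (h : ∑ x ∈ s, (w x : ℝ) ≤ D * C) : ((s.filter fun x => C < w x).card : ℝ) ≤ D := by
  refine le_of_mul_le_mul_right ?_ hC
  rw [← nsmul_eq_mul]
  refine (Finset.card_nsmul_le_sum _ _ _ fun x hx => (Finset.mem_filter.1 hx).2.le).trans ?_
  exact (Finset.sum_le_sum_of_subset_of_nonneg (Finset.filter_subset _ _)
    fun _ _ _ => Nat.cast_nonneg _).trans h

lemma ncard_mem_eq_mul {α β : Type*} [Fintype α] (f : α → β) (T : Finset β) {m : ℕ}
    (h : ∀ a ∈ T, {x | f x = a}.ncard = m) : {x | f x ∈ T}.ncard = T.card * m := by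
  rw [← Finset.coe_filter_univ, Set.ncard_coe_finset,
    Finset.card_eq_sum_card_fiberwise (s := Finset.univ.filter fun x => f x ∈ T) (f := f) (t := T)
      fun x hx => (Finset.mem_filter.1 (Finset.mem_coe.1 hx)).2, Finset.sum_const_nat]
  intro a ha
  rw [← h a ha, ← Set.ncard_coe_finset]
  congr 1
  ext x
  simp only [Finset.coe_filter, Finset.mem_filter, Finset.mem_univ, true_and,
    Set.mem_ofPred_eq, and_iff_right_iff_imp]
  rintro rfl
  exact ha

section Cleaning

variable {n L : ℕ}

/-- The vertices `y` whose cluster does not form a `δ`-regular pair with the cluster of `x`. -/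
noncomputable def irregNbrs (δ : ℝ) (G : Fin n → Fin n → Prop) (f : Fin n → Fin L) (x : Fin n) :
    Finset (Fin n) :=
  Finset.univ.filter fun y => ¬ EpsRegular δ G {z | f z = f x} {z | f z = f y}

/-- The vertices `y` in a cluster of size `m` that forms a `δ`-regular pair with the cluster of
`x`, but in which `x` has too many outneighbours. -/
noncomputable def atypNbrs (δ : ℝ) (G : Fin n → Fin n → Prop) (f : Fin n → Fin L) (m : ℕ)
    (x : Fin n) : Finset (Fin n) :=
  Finset.univ.filter fun y => {z | f z = f y}.ncard = m ∧
    EpsRegular δ G {z | f z = f x} {z | f z = f y} ∧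
    (dens G {z | f z = f x} {z | f z = f y} + δ) * m < ((outN G x ∩ {z | f z = f y}).ncard : ℝ)

lemma card_irregPairs_flip (δ : ℝ) (G : Fin n → Fin n → Prop) (f : Fin n → Fin L) :
    (irregPairs δ (flip G) f).card = (irregPairs δ G f).card := by
  refine Finset.card_bij' (fun p _ => p.swap) (fun p _ => p.swap) ?_ ?_ ?_ ?_ <;>
    simp [irregPairs, epsRegular_flip]

lemma card_many_irregNbrs_le {η : ℝ} (hη : 0 < η) (hn : 0 < n) (G : Fin n → Fin n → Prop)
    (f : Fin n → Fin L) (h : ((irregPairs (η ^ 2) G f).card : ℝ) ≤ η ^ 2 * n ^ 2) :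
    ((Finset.univ.filter fun x => η * n < (irregNbrs (η ^ 2) G f x).card).card : ℝ) ≤ η * n := by
  have hn' : (0 : ℝ) < n := by exact_mod_cast hn
  refine card_filter_lt_le _ _ (by positivity) ?_
  have : (irregPairs (η ^ 2) G f).card = ∑ x, (irregNbrs (η ^ 2) G f x).card := by
    simp only [irregPairs, irregNbrs, Finset.card_filter, Fintype.sum_prod_type]
  rw [this] at h
  push_cast at h
  linarith

lemma card_many_atypNbrs_le {η : ℝ} (hη : 0 < η) (hη1 : η < 1) (hn : 0 < n)
    (G : Fin n → Fin n → Prop) (f : Fin n → Fin L) {m : ℕ} (hm : 0 < m) {a : Fin L}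
    (ha : {x | f x = a}.ncard = m) :
    (((Finset.univ.filter fun x => f x = a).filter
      fun x => η * n < (atypNbrs (η ^ 2) G f m x).card).card : ℝ) ≤ η * m := by
  have hn' : (0 : ℝ) < n := by exact_mod_cast hn
  refine card_filter_lt_le _ _ (by positivity) ?_
  have h1 : ∑ x with f x = a, ((atypNbrs (η ^ 2) G f m x).card : ℝ)
      = ∑ y : Fin n, (((Finset.univ.filter fun x => f x = a).filter
        fun x => y ∈ atypNbrs (η ^ 2) G f m x).card : ℝ) := by
    have := Finset.sum_card_bipartiteAbove_eq_sum_card_bipartiteBelow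
      (s := Finset.univ.filter fun x => f x = a) (t := Finset.univ)
      (fun x y => y ∈ atypNbrs (η ^ 2) G f m x)
    simp only [Finset.bipartiteAbove, Finset.bipartiteBelow, Finset.filter_univ_mem] at this
    exact_mod_cast this
  have h2 (y : Fin n) : (((Finset.univ.filter fun x => f x = a).filter
        fun x => y ∈ atypNbrs (η ^ 2) G f m x).card : ℝ) ≤ η ^ 2 * m := by
    by_cases hy : {z | f z = f y}.ncard = m ∧
        EpsRegular (η ^ 2) G {z | f z = a} {z | f z = f y}
    · have := ncard_outN_large_le (by nlinarith) (hy.1 ▸ hm) hy.2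
      rw [ha] at this
      refine le_trans ?_ this
      rw [← Set.ncard_coe_finset]
      gcongr
      · exact Set.toFinite _
      · intro x hx
        simp only [atypNbrs, Finset.coe_filter, Finset.mem_filter, Finset.mem_univ, true_and,
          Set.mem_ofPred_eq] at hx ⊢
        obtain ⟨rfl, -, -, h⟩ := hx
        rw [hy.1]
        exact ⟨rfl, h⟩
    · rw [Finset.filter_eq_empty_iff.2]
      · simp only [Finset.card_empty, Nat.cast_zero]
        positivity
      · intro x hx hxy
        obtain rfl := (Finset.mem_filter.1 hx).2
        have := (Finset.mem_filter.1 hxy).2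
        exact hy ⟨this.1, this.2.1⟩
  rw [h1]
  calc _ ≤ ∑ _y : Fin n, η ^ 2 * (m : ℝ) := Finset.sum_le_sum fun y _ => h2 y
    _ = η * m * (η * n) := by
      rw [Finset.sum_const, Finset.card_univ, Fintype.card_fin, nsmul_eq_mul]
      ring

/-- The outneighbours of `x` that are lost when cleaning up the digraph. -/
lemma card_lost_le {δ η γ d : ℝ} (hd : 0 ≤ d) (hδ : 0 ≤ δ) (G : Fin n → Fin n → Prop)
    (f : Fin n → Fin L)
    {m : ℕ} (hmγ : (m : ℝ) ≤ γ * n) (S : Finset (Fin L)) (hS : ∀ a ∈ S, {x | f x = a}.ncard = m)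
    (W : Fin L → Set (Fin n)) (hW : ∀ a ∈ S, W a ⊆ {x | f x = a})
    (hWc : ∀ a ∈ S, δ * m < ((W a).ncard : ℝ)) {x : Fin n} (hx : f x ∈ S)
    (hirr : ((irregNbrs δ G f x).card : ℝ) ≤ η * n)
    (hatyp : ((atypNbrs δ G f m x).card : ℝ) ≤ η * n) :
    ((Finset.univ.filter fun y => G x y ∧ f y ∈ S ∧
      (f x = f y ∨ ¬ EpsRegular δ G {z | f z = f x} {z | f z = f y} ∨
        dens G (W (f x)) (W (f y)) < d)).card : ℝ) ≤ (d + 2 * δ + γ + 2 * η) * n := by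
  set S' := S.filter fun b => EpsRegular δ G {z | f z = f x} {z | f z = b} ∧
    ((outN G x ∩ {z | f z = b}).ncard : ℝ) ≤ (dens G {z | f z = f x} {z | f z = b} + δ) * m ∧
    dens G (W (f x)) (W b) < d with hS'
  set R := Finset.univ.filter fun y => G x y ∧ f y ∈ S' with hR
  have hsub : (Finset.univ.filter fun y => G x y ∧ f y ∈ S ∧
      (f x = f y ∨ ¬ EpsRegular δ G {z | f z = f x} {z | f z = f y} ∨
        dens G (W (f x)) (W (f y)) < d))
      ⊆ (Finset.univ.filter fun y => f y = f x) ∪ irregNbrs δ G f x ∪ atypNbrs δ G f m x ∪ R := by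
    intro y hy
    simp only [Finset.mem_filter, Finset.mem_univ, true_and] at hy
    obtain ⟨hG, hyS, h⟩ := hy
    simp only [Finset.mem_union, irregNbrs, atypNbrs, hR, hS', Finset.mem_filter,
      Finset.mem_univ, true_and, hS _ hyS, hG, hyS, ← not_lt]
    tauto
  have hfib : ((Finset.univ.filter fun y => f y = f x).card : ℝ) ≤ γ * n := by
    rw [← Set.ncard_coe_finset, Finset.coe_filter_univ, hS _ hx]
    exact hmγ
  have hS'm : ((S'.card : ℝ) * m) ≤ n := by
    have h := ncard_mem_eq_mul f S' fun a ha => hS a (Finset.mem_filter.1 ha).1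
    have h2 := Set.ncard_le_card {x | f x ∈ S'}
    rw [h, Nat.card_eq_fintype_card, Fintype.card_fin] at h2
    exact_mod_cast h2
  have hRc : (R.card : ℝ) ≤ (d + 2 * δ) * n := by
    have h1 : R.card = ∑ b ∈ S', (outN G x ∩ {z | f z = b}).ncard := by
      rw [Finset.card_eq_sum_card_fiberwise (f := f) (t := S')
        fun y hy => (Finset.mem_filter.1 (Finset.mem_coe.1 hy)).2.2]
      refine Finset.sum_congr rfl fun b hb => ?_
      rw [← Set.ncard_coe_finset]
      congr 1
      ext y
      simp only [hR, outN, Finset.coe_filter, Finset.mem_filter, Finset.mem_univ, true_and,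
        Set.mem_ofPred_eq, Set.mem_inter_iff]
      constructor
      · tauto
      · rintro ⟨h, rfl⟩
        exact ⟨⟨h, hb⟩, rfl⟩
    rw [h1]
    push_cast
    calc _ ≤ ∑ b ∈ S', (d + 2 * δ) * (m : ℝ) := by
          refine Finset.sum_le_sum fun b hb => ?_
          obtain ⟨hbS, hreg, hdeg, hdens⟩ := Finset.mem_filter.1 hb
          refine hdeg.trans ?_
          have := (abs_lt.1 (hreg _ (hW _ hx) _ (hW _ hbS) (by rw [hS _ hx]; exact hWc _ hx)
            (by rw [hS _ hbS]; exact hWc _ hbS))).1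
          exact mul_le_mul_of_nonneg_right (by linarith) (Nat.cast_nonneg m)
      _ = (d + 2 * δ) * ((S'.card : ℝ) * m) := by
          rw [Finset.sum_const, nsmul_eq_mul]
          ring
      _ ≤ _ := by gcongr
  have h1 := (Finset.card_le_card hsub).trans ((Finset.card_union_le _ _).trans
    (Nat.add_le_add_right ((Finset.card_union_le _ _).trans
      (Nat.add_le_add_right (Finset.card_union_le _ _) _)) _))
  have h2 : ((Finset.univ.filter fun y => G x y ∧ f y ∈ S ∧
      (f x = f y ∨ ¬ EpsRegular δ G {z | f z = f x} {z | f z = f y} ∨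
        dens G (W (f x)) (W (f y)) < d)).card : ℝ)
      ≤ ((Finset.univ.filter fun y => f y = f x).card : ℝ) + (irregNbrs δ G f x).card
        + (atypNbrs δ G f m x).card + R.card := by
    exact_mod_cast h1
  linarith

/-- Every vertex of the cleaned clusters `W a` with `a ∈ S` has few neighbours in clusters that
form irregular pairs with its own one or in which its degree is too large. -/
lemma exists_clean_clusters {η γ : ℝ} (hη : 0 < η) (hη1 : η ≤ 1 / 20) (hγ : γ ≤ η) (hn : 0 < n)
    (G : Fin n → Fin n → Prop) {ι : Type*} {Q : Fin n → ι} {f : Fin n → Fin L} {m : ℕ}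
    (hf : IsChunking γ Q f m) (hirr : ((irregPairs (η ^ 2) G f).card : ℝ) ≤ η ^ 2 * n ^ 2) :
    ∃ (S : Finset (Fin L)) (W : Fin L → Set (Fin n)) (m' : ℕ),
      (1 - 2 * η) * m ≤ m' ∧ (1 - 3 * η) * n ≤ S.card * m ∧
      (∀ a ∈ S, {x | f x = a}.ncard = m ∧ W a ⊆ {x | f x = a} ∧ (W a).ncard = m') ∧
      ∀ a ∈ S, ∀ x ∈ W a,
        (((irregNbrs (η ^ 2) G f x).card : ℝ) ≤ η * n ∧
          ((irregNbrs (η ^ 2) (flip G) f x).card : ℝ) ≤ η * n) ∧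
        ((atypNbrs (η ^ 2) G f m x).card : ℝ) ≤ η * n ∧
          ((atypNbrs (η ^ 2) (flip G) f m x).card : ℝ) ≤ η * n := by
  have hn' : (0 : ℝ) < n := by exact_mod_cast hn
  have hm := hf.pos
  have hm' : (0 : ℝ) < m := by exact_mod_cast hm
  have hI1 := card_many_irregNbrs_le hη hn G f hirr
  have hI2 := card_many_irregNbrs_le hη hn (flip G) f (by rwa [card_irregPairs_flip])
  set I1 := Finset.univ.filter fun x => η * n < (irregNbrs (η ^ 2) G f x).card
  set I2 := Finset.univ.filter fun x => η * n < (irregNbrs (η ^ 2) (flip G) f x).card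
  set E := Finset.univ.filter fun x => {y | f y = f x}.ncard ≠ m with hE
  set S : Finset (Fin L) := Finset.univ.filter fun a => {x | f x = a}.ncard = m ∧
    ∀ x, f x = a → x ∉ I1 ∧ x ∉ I2 with hS
  have hSm : ∀ a ∈ S, {x | f x = a}.ncard = m := fun a ha => (Finset.mem_filter.1 ha).2.1
  have hcover : (Finset.univ : Finset (Fin n))
      ⊆ (Finset.univ.filter fun x => f x ∈ S) ∪ E ∪ I1 ∪ I2 := by
    intro x _
    by_contra hx
    simp only [Finset.mem_union, not_or] at hx
    obtain ⟨⟨⟨h1, h2⟩, h3⟩, h4⟩ := hx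
    refine h1 (Finset.mem_filter.2 ⟨Finset.mem_univ _, Finset.mem_filter.2
      ⟨Finset.mem_univ _, ?_, fun z hz => ?_⟩⟩)
    · by_contra h
      exact h2 (Finset.mem_filter.2 ⟨Finset.mem_univ _, h⟩)
    · have hz1 : irregNbrs (η ^ 2) G f z = irregNbrs (η ^ 2) G f x := by
        simp only [irregNbrs, hz]
      have hz2 : irregNbrs (η ^ 2) (flip G) f z = irregNbrs (η ^ 2) (flip G) f x := by
        simp only [irregNbrs, hz]
      exact ⟨fun h => h3 (Finset.mem_filter.2
          ⟨Finset.mem_univ _, hz1 ▸ (Finset.mem_filter.1 h).2⟩),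
        fun h => h4 (Finset.mem_filter.2 ⟨Finset.mem_univ _, hz2 ▸ (Finset.mem_filter.1 h).2⟩)⟩
  have hSc : (1 - 3 * η) * n ≤ S.card * m := by
    have h1 := (Finset.card_le_card hcover).trans ((Finset.card_union_le _ _).trans
      (Nat.add_le_add_right ((Finset.card_union_le _ _).trans
        (Nat.add_le_add_right (Finset.card_union_le _ _) _)) _))
    rw [← Set.ncard_coe_finset (Finset.univ.filter fun x => f x ∈ S), Finset.coe_filter_univ,
      ncard_mem_eq_mul f S hSm, Finset.card_univ, Fintype.card_fin] at h1
    have h2 : (n : ℝ) ≤ S.card * m + E.card + I1.card + I2.card := by exact_mod_cast h1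
    have h3 : (E.card : ℝ) ≤ γ * n := hf.card_le
    nlinarith
  have hW (a : Fin L) : ∃ W : Finset (Fin n), a ∈ S → (∀ x ∈ W, f x = a ∧
      ((atypNbrs (η ^ 2) G f m x).card : ℝ) ≤ η * n ∧
      ((atypNbrs (η ^ 2) (flip G) f m x).card : ℝ) ≤ η * n) ∧
      W.card = ⌈(1 - 2 * η) * m⌉₊ := by
    by_cases ha : a ∈ S
    · have hA1 := card_many_atypNbrs_le hη (by linarith) hn G f hm (hSm a ha)
      have hA2 := card_many_atypNbrs_le hη (by linarith) hn (flip G) f hm (hSm a ha)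
      set A := Finset.univ.filter fun x => f x = a with hA
      set A1 := A.filter fun x => η * n < (atypNbrs (η ^ 2) G f m x).card with hA1'
      set A2 := A.filter fun x => η * n < (atypNbrs (η ^ 2) (flip G) f m x).card with hA2'
      have hAc : A.card = m := by
        rw [← hSm a ha, ← Set.ncard_coe_finset, hA, Finset.coe_filter_univ]
      have hle : ⌈(1 - 2 * η) * m⌉₊ ≤ (A \ (A1 ∪ A2)).card := by
        rw [Nat.ceil_le]
        have h1 := Finset.le_card_sdiff (A1 ∪ A2) A
        have h2 := Finset.card_union_le A1 A2
        have h3 : (m : ℝ) ≤ (A \ (A1 ∪ A2)).card + (A1.card + A2.card) := by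
          exact_mod_cast (by omega : m ≤ (A \ (A1 ∪ A2)).card + (A1.card + A2.card))
        linarith
      obtain ⟨W, hWs, hWc⟩ := Finset.exists_subset_card_eq hle
      refine ⟨W, fun _ => ⟨fun x hx => ?_, hWc⟩⟩
      have hx' := hWs hx
      simp only [hA1', hA2', Finset.mem_sdiff, Finset.mem_union, Finset.mem_filter, not_or, not_and,
        not_lt] at hx'
      exact ⟨(Finset.mem_filter.1 hx'.1).2, hx'.2.1 hx'.1, hx'.2.2 hx'.1⟩
    · exact ⟨∅, fun h => absurd h ha⟩
  choose W hW using hW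
  refine ⟨S, fun a => W a, ⌈(1 - 2 * η) * m⌉₊, Nat.le_ceil _, hSc, fun a ha =>
    ⟨hSm a ha, fun x hx => ((hW a ha).1 x hx).1, ?_⟩, fun a ha x hx => ⟨?_, ((hW a ha).1 x hx).2⟩⟩
  · rw [Set.ncard_coe_finset, (hW a ha).2]
  · have := (Finset.mem_filter.1 ha).2.2 x ((hW a ha).1 x hx).1
    simpa [I1, I2] using this

lemma outDeg_sub_lt {G G' : Fin n → Fin n → Prop} {x : Fin n} {c : ℝ}
    (h : ((Finset.univ.filter fun y => G x y ∧ ¬ G' x y).card : ℝ) < c) :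
    (outDeg G x : ℝ) - c < outDeg G' x := by
  have hsub : outN G x ⊆ outN G' x ∪ {y | G x y ∧ ¬ G' x y} := by
    intro y hy
    by_cases hy' : G' x y
    · exact Or.inl hy'
    · exact Or.inr ⟨hy, hy'⟩
  have h1 := (Set.ncard_le_ncard hsub).trans (Set.ncard_union_le _ _)
  rw [← Finset.coe_filter_univ, Set.ncard_coe_finset] at h1
  have h2 : (outDeg G x : ℝ) ≤ outDeg G' x
      + (Finset.univ.filter fun y => G x y ∧ ¬ G' x y).card := by exact_mod_cast h1
  linarith

end Cleaning

end Auxiliary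

/-- **Lemma 2 (degree form of the Diregularity Lemma).**
For every `ε ∈ (0,1)` and all `M'`, `M''` there are `M` and `n₀` such that every digraph `G`
on `n ≥ n₀` vertices, every initial partition `U₀, …, U_{M''}` of its vertices (encoded by
`Q`) and every `d ∈ [0,1]` admit a partition `V₀, V₁, …, V_k` (encoded by `P`) and a
spanning subdigraph `G'` with the listed properties. -/
theorem diregularity_lemma_degree_form :
    ∀ ε : ℝ, 0 < ε → ε < 1 →
    ∀ M' M'' : ℕ, 0 < M' → 0 < M'' →
    ∃ M n₀ : ℕ,
    ∀ n : ℕ, n₀ ≤ n →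
    ∀ G : Fin n → Fin n → Prop, (∀ x, ¬ G x x) →
    ∀ Q : Fin n → Fin (M'' + 1),
    ∀ d : ℝ, 0 ≤ d → d ≤ 1 →
    ∃ (k : ℕ) (P : Fin n → Option (Fin k)) (G' : Fin n → Fin n → Prop) (m : ℕ),
      M' ≤ k ∧ k ≤ M ∧
      -- `G'` is a spanning subdigraph of `G`
      (∀ x y, G' x y → G x y) ∧
      -- `|V₀| ≤ ε n`
      ((cluster0 P).ncard : ℝ) ≤ ε * n ∧
      -- `|V₁| = … = |V_k| = m`
      (∀ i : Fin k, (cluster P i).ncard = m) ∧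
      -- `V₀, V₁, …, V_k` refines `U₀, …, U_{M''}`
      (∀ i : Fin k, ∃ j : Fin (M'' + 1), cluster P i ⊆ {x | Q x = j}) ∧
      -- degree conditions
      (∀ x, (outDeg G x : ℝ) - (d + ε) * n < (outDeg G' x : ℝ)) ∧
      (∀ x, (inDeg G x : ℝ) - (d + ε) * n < (inDeg G' x : ℝ)) ∧
      -- each `G'[V_i]` is empty
      (∀ i : Fin k, ∀ x ∈ cluster P i, ∀ y ∈ cluster P i, ¬ G' x y) ∧
      -- all pairs are `ε`-regular with density `0` or at least `d`
      (∀ i j : Fin k, i ≠ j →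
        EpsRegular ε G' (cluster P i) (cluster P j) ∧
        (dens G' (cluster P i) (cluster P j) = 0 ∨
          d ≤ dens G' (cluster P i) (cluster P j))) := by
  classical
  intro ε hε hε1 M' M'' hM' hM''
  have hM'r : (0 : ℝ) < M' := by exact_mod_cast hM'
  obtain ⟨η, hη⟩ : ∃ η, η = ε / 20 := ⟨_, rfl⟩
  have hη0 : 0 < η := by rw [hη]; positivity
  have hη1 : η ≤ 1 / 20 := by rw [hη]; linarith
  have hη2 : η ^ 2 ≤ η / 20 := by nlinarith
  obtain ⟨γ, hγ⟩ : ∃ γ, γ = min η (1 / (2 * M') : ℝ) := ⟨_, rfl⟩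
  have hγ0 : 0 < γ := by rw [hγ]; positivity
  have hγη : γ ≤ η := by rw [hγ]; exact min_le_left _ _
  have hγM : γ ≤ 1 / (2 * M') := by rw [hγ]; exact min_le_right _ _
  obtain ⟨M, n₀, hreg⟩ := exists_chunking_regular (ε := η ^ 2) (by positivity) hγ0
    (K := M'' + 1) (by omega)
  refine ⟨M, max n₀ 1, fun n hn G hG Q d hd hd1 => ?_⟩
  have hn0 : 0 < n := (le_max_right _ _).trans hn
  have hn' : (0 : ℝ) < n := by exact_mod_cast hn0
  obtain ⟨L, hL, f, m, hf, hirr⟩ := hreg n ((le_max_left _ _).trans hn) G Q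
  obtain ⟨S, W, m', hm'm, hSm, hSW, hW⟩ := exists_clean_clusters hη0 hη1 hγη hn0 G hf hirr
  have hm : (0 : ℝ) < m := by exact_mod_cast hf.pos
  have hδm : η ^ 2 * m < m' := by nlinarith
  have hδε : η ^ 2 * m ≤ ε * m' := by
    have : ε = 20 * η := by rw [hη]; ring
    rw [this]
    nlinarith
  let e := S.equivFin
  let P : Fin n → Option (Fin S.card) := fun x =>
    if h : f x ∈ S ∧ x ∈ W (f x) then some (e ⟨f x, h.1⟩) else none
  have hP (x : Fin n) (i : Fin S.card) : P x = some i ↔ x ∈ W (e.symm i) := by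
    constructor
    · intro h
      by_cases hx : f x ∈ S ∧ x ∈ W (f x)
      · simp only [P, hx, and_self, dif_pos, Option.some.injEq] at h
        rw [← h, Equiv.symm_apply_apply]
        exact hx.2
      · simp [P, hx] at h
    · intro h
      have hfx : f x = e.symm i := (hSW _ (e.symm i).2).2.1 h
      have hx : f x ∈ S ∧ x ∈ W (f x) := by
        rw [hfx]
        exact ⟨(e.symm i).2, h⟩
      rw [show P x = some (e ⟨f x, hx.1⟩) from dif_pos hx, Option.some_inj,
        ← Equiv.eq_symm_apply]
      exact Subtype.ext hfx
  have hPnone (x : Fin n) (h : P x ≠ none) : f x ∈ S ∧ x ∈ W (f x) := by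
    by_contra hx
    exact h (dif_neg hx)
  have hcl (i : Fin S.card) : cluster P i = W (e.symm i) := Set.ext fun x => hP x i
  have hfcl {i : Fin S.card} {x : Fin n} (hx : x ∈ W (e.symm i)) : f x = e.symm i :=
    (hSW _ (e.symm i).2).2.1 hx
  let H : Fin n → Fin n → Prop := fun x y => f x ≠ f y ∧
    EpsRegular (η ^ 2) G {z | f z = f x} {z | f z = f y} ∧ d ≤ dens G (W (f x)) (W (f y))
  obtain ⟨G', hG'⟩ : ∃ G' : Fin n → Fin n → Prop,
      ∀ x y, G' x y ↔ G x y ∧ (P x = none ∨ P y = none ∨ H x y) := ⟨_, fun _ _ => Iff.rfl⟩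
  have hdeg : (d + 2 * η ^ 2 + γ + 2 * η) * n < (d + ε) * n := by
    refine mul_lt_mul_of_pos_right ?_ hn'
    rw [hη] at *
    linarith
  have hdeg0 : 0 < (d + ε) * n := by positivity
  have hWc (a : Fin L) (ha : a ∈ S) : η ^ 2 * m < ((W a).ncard : ℝ) := by
    rw [(hSW a ha).2.2]
    exact hδm
  refine ⟨S.card, P, G', m', ?_, ?_, fun x y h => ((hG' x y).1 h).1, ?_, ?_, ?_, ?_, ?_, ?_, ?_⟩
  · have h1 : (m : ℝ) * (2 * M') ≤ n := by
      have h2 := hf.size_le.trans (mul_le_mul_of_nonneg_right hγM hn'.le)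
      rwa [div_mul_eq_mul_div, one_mul, le_div_iff₀ (by positivity)] at h2
    have h3 : (M' : ℝ) * m ≤ S.card * m := by nlinarith
    exact_mod_cast le_of_mul_le_mul_right h3 hm
  · exact (Finset.card_le_univ S).trans (by rwa [Fintype.card_fin])
  · have hcompl : (cluster0 P)ᶜ = {x | P x ∈ Finset.univ.image (some : Fin S.card → _)} := by
      ext x
      rcases h : P x with _ | i <;> simp [cluster0, h]
    have h1 := Set.ncard_add_ncard_compl (cluster0 P)
    rw [hcompl, ncard_mem_eq_mul P _ (m := m') ?_, Nat.card_eq_fintype_card, Fintype.card_fin,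
      Finset.card_image_of_injective _ (Option.some_injective _), Finset.card_univ,
      Fintype.card_fin] at h1
    · have h2 : ((cluster0 P).ncard : ℝ) + S.card * m' = n := by exact_mod_cast h1
      have h3 : (S.card : ℝ) * ((1 - 2 * η) * m) ≤ S.card * m' := by gcongr
      have h4 : (1 - 2 * η) * ((1 - 3 * η) * n) ≤ (1 - 2 * η) * (S.card * m) :=
        mul_le_mul_of_nonneg_left hSm (by linarith)
      have h5 : (1 - 5 * η) * n ≤ (1 - 2 * η) * ((1 - 3 * η) * n) := by
        rw [← mul_assoc]
        exact mul_le_mul_of_nonneg_right (by nlinarith) hn'.le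
      have h6 : 5 * η * n ≤ ε * n := mul_le_mul_of_nonneg_right (by linarith) hn'.le
      nlinarith
    · intro o ho
      obtain ⟨i, -, rfl⟩ := Finset.mem_image.1 ho
      have := hcl i
      rw [cluster] at this
      rw [this, (hSW _ (e.symm i).2).2.2]
  · intro i
    rw [hcl, (hSW _ (e.symm i).2).2.2]
  · intro i
    obtain ⟨φ, hφ⟩ := hf.factors
    refine ⟨φ (e.symm i), fun x hx => ?_⟩
    rw [hcl] at hx
    change Q x = _
    rw [hφ, hfcl hx]
  · intro x
    refine outDeg_sub_lt ?_
    by_cases hx : P x = none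
    · rw [Finset.filter_eq_empty_iff.2 fun y _ h => h.2 ((hG' _ _).2 ⟨h.1, Or.inl hx⟩)]
      simpa using hdeg0
    obtain ⟨hxS, hxW⟩ := hPnone x hx
    obtain ⟨⟨h1, h2⟩, h3, h4⟩ := hW _ hxS x hxW
    refine lt_of_le_of_lt (le_trans (Nat.cast_le.2 (Finset.card_le_card fun y hy => ?_))
      (card_lost_le hd (by positivity) G f hf.size_le S (fun a ha => (hSW a ha).1) W
        (fun a ha => (hSW a ha).2.1) hWc hxS h1 h3)) hdeg
    simp only [Finset.mem_filter, Finset.mem_univ, true_and] at hy ⊢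
    have hy2 : ¬ (P x = none ∨ P y = none ∨ H x y) := fun h => hy.2 ((hG' _ _).2 ⟨hy.1, h⟩)
    push Not at hy2
    refine ⟨hy.1, (hPnone y hy2.2.1).1, ?_⟩
    rw [← not_le]
    by_contra hcon
    exact hy2.2.2 (by simpa only [H, not_or, not_not] using hcon)
  · intro x
    refine outDeg_sub_lt (G := flip G) (G' := flip G') ?_
    by_cases hx : P x = none
    · rw [Finset.filter_eq_empty_iff.2 fun y _ h => h.2 ((hG' _ _).2 ⟨h.1, Or.inr (Or.inl hx)⟩)]
      simpa using hdeg0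
    obtain ⟨hxS, hxW⟩ := hPnone x hx
    obtain ⟨⟨h1, h2⟩, h3, h4⟩ := hW _ hxS x hxW
    refine lt_of_le_of_lt (le_trans (Nat.cast_le.2 (Finset.card_le_card fun y hy => ?_))
      (card_lost_le hd (by positivity) (flip G) f hf.size_le S (fun a ha => (hSW a ha).1) W
        (fun a ha => (hSW a ha).2.1) hWc hxS h2 h4)) hdeg
    simp only [Finset.mem_filter, Finset.mem_univ, true_and] at hy ⊢
    have hy2 : ¬ (P y = none ∨ P x = none ∨ H y x) := fun h => hy.2 ((hG' _ _).2 ⟨hy.1, h⟩)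
    push Not at hy2
    refine ⟨hy.1, (hPnone y hy2.1).1, ?_⟩
    rw [← not_le, epsRegular_flip, dens_flip, eq_comm]
    by_contra hcon
    exact hy2.2.2 (by simpa only [H, not_or, not_not] using hcon)
  · intro i x hx y hy hxy
    have hxP : P x = some i := hx
    have hyP : P y = some i := hy
    rw [hcl] at hx hy
    rcases ((hG' x y).1 hxy).2 with h | h | h
    · simp [hxP] at h
    · simp [hyP] at h
    · exact h.1 ((hfcl hx).trans (hfcl hy).symm)
  · intro i j hij
    rw [hcl, hcl]
    have hi := hSW _ (e.symm i).2
    have hj := hSW _ (e.symm j).2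
    have hGW : ∀ x ∈ W (e.symm i), ∀ y ∈ W (e.symm j), G' x y ↔ G x y ∧
        EpsRegular (η ^ 2) G {z | f z = e.symm i} {z | f z = e.symm j} ∧
        d ≤ dens G (W (e.symm i)) (W (e.symm j)) := by
      intro x hx y hy
      have hne : (e.symm i : Fin L) ≠ e.symm j := fun h =>
        hij (e.symm.injective (Subtype.ext h))
      simp only [hG', H, (hP x i).2 hx, (hP y j).2 hy, hfcl hx, hfcl hy, reduceCtorEq, false_or,
        ne_eq, hne, not_false_eq_true, true_and]
    by_cases hkeep : EpsRegular (η ^ 2) G {z | f z = e.symm i} {z | f z = e.symm j} ∧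
        d ≤ dens G (W (e.symm i)) (W (e.symm j))
    · have hGG' : ∀ x ∈ W (e.symm i), ∀ y ∈ W (e.symm j), G x y ↔ G' x y := fun x hx y hy => by
        rw [hGW x hx y hy]
        exact (and_iff_left hkeep).symm
      refine ⟨(hkeep.1.subset hi.2.1 hj.2.1 ?_ ?_ ?_ ?_ ?_).congr hGG', Or.inr ?_⟩
      · rw [hi.1, hi.2.2]; exact hδm
      · rw [hj.1, hj.2.2]; exact hδm
      · rw [hi.1, hi.2.2]; exact hδε
      · rw [hj.1, hj.2.2]; exact hδε
      · linarith
      · rw [← dens_congr hGG']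
        exact hkeep.2
    · have hno : ∀ x ∈ W (e.symm i), ∀ y ∈ W (e.symm j), ¬ G' x y := fun x hx y hy h =>
        hkeep ((hGW x hx y hy).1 h).2
      exact ⟨epsRegular_of_forall_not hε hno, Or.inl (dens_eq_zero hno)⟩

end ArxivOG
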